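/- arXiv:2101.09107 — 2 statements merged into one kernel-verified Lean document; each statement's English description precedes it below -/
import Mathlib

section
/- Setting-locality of protocol states: for every l ∈ {0,1,…,N}, every time t, and every history H, the state ψ_{(l,t,H)} is unchanged if any setting x_i of a lab i whose triple does not occur in H is replaced by a different setting (i.e., ψ_{(l,t,H)} depends on the settings x_1,…,x_N only through the settings appearing in H). Consequently, the probabilities p_k(l_k|H_{k−1}) of Definition 4 depend only on the settings appearing in H_{k−1}, and the probabilities p_k(a_{l_k}|H_{k−1}, x_{l_k}) of Definition 5 depend only on those settings together with x_{l_k}. -/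
noncomputable section

/-!
Shared framework: quantum protocols with a quantum control of causal order,
following Purves & Short, "Quantum theory cannot violate a causal inequality".

The total Hilbert space `H_s ⊗ H_c ⊗ (⊗ᵢ H_{rᵢ}) ⊗ (⊗ᵢ H_{fᵢ})` is modelled
concretely as `ℓ²` of the finite basis-index set
`Idx = S × Fin (N+1) × (Π i, A i) × (Π i, Fin (T+1))`
(system basis, control basis |0⟩,…,|N⟩, result-register bases, flag bases),
vectors being functions `Idx → ℂ`, operators being matrices.
-/

namespace CIQ

variable {N T : ℕ} {S : Type} [Fintype S] [DecidableEq S]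
variable {A : Fin N → Type} [∀ i, Fintype (A i)] [∀ i, DecidableEq (A i)]
variable {X : Fin N → Type} [∀ i, Fintype (X i)] [∀ i, DecidableEq (X i)]

/-- Basis index set of the total Hilbert space: system × control × results × flags. -/
abbrev Idx (N T : ℕ) (S : Type) (A : Fin N → Type) : Type :=
  S × Fin (N + 1) × ((i : Fin N) → A i) × ((i : Fin N) → Fin (T + 1))

/-- A history: an ordered list of triples (lab, outcome, setting). -/
abbrev Hist (N : ℕ) (A X : Fin N → Type) : Type := List ((l : Fin N) × (A l × X l))

/-- The labs occurring in a history are pairwise distinct. -/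
def labsDistinct (H : Hist N A X) : Prop := (H.map Sigma.fst).Nodup

/-- Squared ℓ²-norm ‖v‖². -/
def nsq (v : Idx N T S A → ℂ) : ℝ := ∑ p, Complex.normSq (v p)

/-- The ℓ² inner product ⟨v|w⟩ (conjugate-linear in the first argument). -/
def hinner (v w : Idx N T S A → ℂ) : ℂ := ∑ p, (starRingEnd ℂ) (v p) * w p

/-- The data of a quantum protocol: a distinguished initial system basis state `s0`,
initial result-register states `r0`, measurement unitaries `Vm l x` on `H_s ⊗ H_{r_l}`
for each lab and setting, and inter-step unitaries `U t` on `H_s ⊗ H_c` (for `1 ≤ t ≤ T`). -/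
structure Protocol (N T : ℕ) (S : Type) (A X : Fin N → Type) where
  s0 : S
  r0 : ∀ i, A i
  Vm : (l : Fin N) → X l → Matrix (S × A l) (S × A l) ℂ
  U : ℕ → Matrix (S × Fin (N + 1)) (S × Fin (N + 1)) ℂ

/-- Extension of an operator on `H_s ⊗ H_c` by the identity on results and flags. -/
def extSC (M : Matrix (S × Fin (N + 1)) (S × Fin (N + 1)) ℂ) :
    Matrix (Idx N T S A) (Idx N T S A) ℂ := fun p q =>
  if p.2.2 = q.2.2 then M (p.1, p.2.1) (q.1, q.2.1) else 0

namespace Protocol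

variable (P : Protocol N T S A X) (x : ∀ l, X l)

/-- Each measurement unitary is indeed unitary. -/
def unitaryVm : Prop := ∀ (l : Fin N) (xv : X l), P.Vm l xv ∈ Matrix.unitaryGroup (S × A l) ℂ

/-- Each inter-step unitary `U t`, `1 ≤ t ≤ T`, is indeed unitary. -/
def unitaryU : Prop :=
  ∀ t : ℕ, 1 ≤ t → t ≤ T → P.U t ∈ Matrix.unitaryGroup (S × Fin (N + 1)) ℂ

/-- The initial state |0⟩ = |0⟩_s |0⟩_c |0⟩_r^N |0⟩_f^N. -/
def ket0 : Idx N T S A → ℂ :=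
  fun p => if p = (P.s0, 0, P.r0, fun _ => 0) then 1 else 0

/-- The lab-activation unitary
`V = |0⟩⟨0|_c ⊗ I + Σ_{l=1}^N |l⟩⟨l|_c ⊗ V_{s,r_l}(x_l) ⊗ Γ_{f_l} ⊗ I`,
where `Γ` is the cyclic shift raising the flag. -/
def Vmat : Matrix (Idx N T S A) (Idx N T S A) ℂ := fun p q =>
  if h : p.2.1 = (0 : Fin (N + 1)) then (if q = p then 1 else 0)
  else
    if q.2.1 = p.2.1 ∧ (∀ i, i ≠ p.2.1.pred h → q.2.2.1 i = p.2.2.1 i)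
        ∧ (∀ i, i ≠ p.2.1.pred h → q.2.2.2 i = p.2.2.2 i)
        ∧ q.2.2.2 (p.2.1.pred h) + 1 = p.2.2.2 (p.2.1.pred h) then
      P.Vm (p.2.1.pred h) (x (p.2.1.pred h))
        (p.1, p.2.2.1 (p.2.1.pred h)) (q.1, q.2.2.1 (p.2.1.pred h))
    else 0

/-- `chain t = V U_t V U_{t-1} ⋯ V U_1`. -/
def chain : ℕ → Matrix (Idx N T S A) (Idx N T S A) ℂ
  | 0 => 1
  | t + 1 => P.Vmat x * (extSC (P.U (t + 1)) * chain t)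

/-- `pre t = U_t V U_{t-1} ⋯ V U_1` (the evolution just before the `t`-th activation). -/
def pre (t : ℕ) : Matrix (Idx N T S A) (Idx N T S A) ℂ :=
  extSC (P.U t) * P.chain x (t - 1)

/-- The total unitary `𝒰 = V U_T V U_{T-1} ⋯ V U_1`. -/
def Uop : Matrix (Idx N T S A) (Idx N T S A) ℂ := P.chain x T

/-- `tailPhi k = V U_T V U_{T-1} ⋯ U_{T-k+1}` (evolution to the end of the protocol,
starting just after the `(T-k)`-th activation); `k` counts remaining time steps. -/
def tailPhi : ℕ → Matrix (Idx N T S A) (Idx N T S A) ℂ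
  | 0 => 1
  | k + 1 => tailPhi k * (P.Vmat x * extSC (P.U (T - k)))

end Protocol

/-- The condition imposed by the projector `π^H_{rf}`: result registers of labs in the
history `H` show the recorded outcomes and their flags are raised (to `1`), while the
flags of all other labs read `0`. -/
def histSat (H : Hist N A X) (rr : ∀ i, A i) (ff : (i : Fin N) → Fin (T + 1)) : Prop :=
  (∀ e ∈ H, rr e.1 = e.2.1 ∧ ff e.1 = 1) ∧ (∀ i : Fin N, (∀ e ∈ H, e.1 ≠ i) → ff i = 0)

instance (H : Hist N A X) (rr : ∀ i, A i) (ff : (i : Fin N) → Fin (T + 1)) :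
    Decidable (histSat H rr ff) := by
  unfold histSat; infer_instance

namespace Protocol

variable (P : Protocol N T S A X) (x : ∀ l, X l)

/-- `|ψ_{(l,t,H)}⟩ = (|l⟩⟨l|_c ⊗ π^H_{rf} ⊗ I_s) U_t V U_{t-1} ⋯ V U_1 |0⟩`,
where the control value `l ∈ {0,1,…,N}`. -/
def psi (l : Fin (N + 1)) (t : ℕ) (H : Hist N A X) : Idx N T S A → ℂ := fun p =>
  if p.2.1 = l ∧ histSat H p.2.2.1 p.2.2.2 then (P.pre x t).mulVec (P.ket0) p else 0

/-- `|ψ̄_{(l,t,H)}⟩ = V U_T V U_{T-1} ⋯ U_{t+1} V |ψ_{(l,t,H)}⟩`. -/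
def psibar (l : Fin (N + 1)) (t : ℕ) (H : Hist N A X) : Idx N T S A → ℂ :=
  (P.tailPhi x (T - t) * P.Vmat x).mulVec (P.psi x l t H)

/-- The just-measured state with previous history `H`:
`(|a⟩⟨a|_{r_l} ⊗ I) V |ψ_{(l,t,H)}⟩` (control value `l` among `1,…,N`). -/
def phiOf (l : Fin N) (a : A l) (t : ℕ) (H : Hist N A X) : Idx N T S A → ℂ := fun p =>
  if p.2.2.1 l = a then (P.Vmat x).mulVec (P.psi x l.succ t H) p else 0

/-- `|φ_{(l,t,H)}⟩` for a lab `l` whose triple `(l, a, x_l)` occurs in the history `H`: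
`(|a⟩⟨a|_{r_l} ⊗ I) V |ψ_{(l,t,H∖(l,a,x_l))}⟩`. -/
def phiFull (l : Fin N) (a : A l) (t : ℕ) (H : Hist N A X) : Idx N T S A → ℂ :=
  P.phiOf x l a t (H.filter fun e => decide (e.1 ≠ l))

/-- `|φ̄_{(l,t,H)}⟩ = V U_T V ⋯ U_{t+1} |φ_{(l,t,H)}⟩`. -/
def phibar (l : Fin N) (a : A l) (t : ℕ) (H : Hist N A X) : Idx N T S A → ℂ :=
  (P.tailPhi x (T - t)).mulVec (P.phiFull x l a t H)

/-- `|φ_{(0,t,H)}⟩ = V |ψ_{(0,t,H)}⟩`. -/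
def phi0 (t : ℕ) (H : Hist N A X) : Idx N T S A → ℂ :=
  (P.Vmat x).mulVec (P.psi x 0 t H)

/-- `|φ̄_{(0,t,H)}⟩ = V U_T V ⋯ U_{t+1} |φ_{(0,t,H)}⟩`. -/
def phibar0 (t : ℕ) (H : Hist N A X) : Idx N T S A → ℂ :=
  (P.tailPhi x (T - t)).mulVec (P.phi0 x t H)

/-- `Σ_{t=1}^T ‖ψ_{(l,t,H)}‖²` (numerator of Definition 4). -/
def numPsi (H : Hist N A X) (l : Fin N) : ℝ :=
  ∑ t ∈ Finset.Icc 1 T, nsq (P.psi x l.succ t H)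

/-- `Σ_{l'∉ℒ} Σ_{t=1}^T ‖ψ_{(l',t,H)}‖²` (denominator of Definition 4). -/
def denPsi (H : Hist N A X) : ℝ :=
  ∑ l ∈ Finset.univ.filter (fun l : Fin N => ∀ e ∈ H, e.1 ≠ l), P.numPsi x H l

/-- Definition 4: `p_k(l_k|H_{k-1})`, the probability for lab `l` to act next. -/
def pNext (H : Hist N A X) (l : Fin N) : ℝ := P.numPsi x H l / P.denPsi x H

/-- `Σ_{t=1}^T ‖φ_{(l,t,(H,(l,a,x_l)))}‖²` (numerator of Definition 5). -/
def numPhi (H : Hist N A X) (l : Fin N) (a : A l) : ℝ :=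
  ∑ t ∈ Finset.Icc 1 T, nsq (P.phiOf x l a t H)

/-- Definition 5: `p_k(a|H_{k-1},x_l)`, the probability for lab `l`, acting next after
history `H` with its setting `x l`, to obtain outcome `a`. -/
def pOut (H : Hist N A X) (l : Fin N) (a : A l) : ℝ :=
  P.numPhi x H l a / ∑ a' : A l, P.numPhi x H l a'

/-- The quantum outcome distribution
`p^quantum(a⃗|x⃗) = ‖(|a⃗⟩⟨a⃗|_r ⊗ I) 𝒰 |0⟩‖²`. -/
def pQ (a : ∀ i, A i) : ℝ :=
  nsq (fun p => if p.2.2.1 = a then (P.Uop x).mulVec P.ket0 p else 0)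

/-- The flag constraint: at the end of the protocol every flag reads `1`
(each party has interacted with the system exactly once). -/
def flagOK : Prop :=
  ∀ p : Idx N T S A, (P.Uop x).mulVec P.ket0 p ≠ 0 → ∀ i, p.2.2.2 i = 1

end Protocol

/-- The causal-model expression of Definition 1, written recursively:
`causalSum q o x a k H` sums over the next `k` parties to act (those not in `H`),
multiplying the 'who is next?' probabilities `q` and the 'what did they see?'
probabilities `o`, with the history extended accordingly.  The full expression
of Definition 1 is `causalSum q o x a N []`. -/
def causalSum (q : Hist N A X → Fin N → ℝ)
    (o : Hist N A X → (l : Fin N) → X l → A l → ℝ)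
    (x : ∀ i, X i) (a : ∀ i, A i) : ℕ → Hist N A X → ℝ
  | 0, _ => 1
  | k + 1, H =>
      ∑ l : Fin N,
        if ∀ e ∈ H, e.1 ≠ l then
          q H l * o H l (x l) (a l) * causalSum q o x a k (H ++ [⟨l, (a l, x l)⟩])
        else 0

end CIQ

end


open CIQ CIQ.Protocol

namespace CIQ

variable {N T : ℕ} {S : Type} [Fintype S]
variable {A : Fin N → Type} [∀ i, Fintype (A i)] [∀ i, DecidableEq (A i)]
variable {X : Fin N → Type}

/-- `extSC M` acts within each fixed configuration of results and flags. -/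
lemma extSC_mulVec_congr (M : Matrix (S × Fin (N + 1)) (S × Fin (N + 1)) ℂ)
    {v w : Idx N T S A → ℂ} {p : Idx N T S A} (h : ∀ q, q.2.2 = p.2.2 → v q = w q) :
    (extSC M).mulVec v p = (extSC M).mulVec w p := by
  refine Finset.sum_congr rfl fun q _ => ?_
  by_cases hq : p.2.2 = q.2.2
  · rw [h q hq.symm]
  · simp [extSC, hq]

lemma extSC_mulVec_eq_zero (M : Matrix (S × Fin (N + 1)) (S × Fin (N + 1)) ℂ)
    {v : Idx N T S A → ℂ} {p : Idx N T S A} (h : ∀ q, q.2.2 = p.2.2 → v q = 0) :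
    (extSC M).mulVec v p = 0 := by
  rw [extSC_mulVec_congr M (w := 0) h, Matrix.mulVec_zero, Pi.zero_apply]

namespace Protocol

variable [DecidableEq S] (P : Protocol N T S A X)

lemma chain_succ_mulVec (x : ∀ l, X l) (k : ℕ) (v : Idx N T S A → ℂ) :
    (P.chain x (k + 1)).mulVec v =
      (P.Vmat x).mulVec ((extSC (P.U (k + 1))).mulVec ((P.chain x k).mulVec v)) := by
  simp [chain, Matrix.mulVec_mulVec]

/-- After `k` activations no flag exceeds `k`. -/
lemma chain_mulVec_ket0_eq_zero (x : ∀ l, X l) (k : ℕ) (p : Idx N T S A) (i : Fin N)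
    (hp : k < (p.2.2.2 i).val) : (P.chain x k).mulVec P.ket0 p = 0 := by
  induction k generalizing p with
  | zero =>
    have hne : p ≠ (P.s0, 0, P.r0, fun _ => 0) := by
      rintro rfl
      simp at hp
    simp [chain, ket0, hne]
  | succ k ih =>
    rw [chain_succ_mulVec]
    refine Finset.sum_eq_zero fun q _ => ?_
    beta_reduce
    by_cases hq : k < (q.2.2.2 i).val
    · rw [extSC_mulVec_eq_zero _ fun r hr => ih r (by rwa [hr]), mul_zero]
    · suffices P.Vmat x p q = 0 by rw [this, zero_mul]
      unfold Vmat
      split_ifs with hc hqp hcond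
      · subst hqp
        omega
      · rfl
      · obtain ⟨-, -, hf, hl⟩ := hcond
        exfalso
        by_cases hi : i = p.2.1.pred hc
        · rw [← hi] at hl
          rw [← hl, Fin.val_add_one] at hp
          split_ifs at hp <;> omega
        · rw [hf i hi] at hq
          omega
      · rfl

/-- Amplitudes in which every lab with a changed setting still has its flag lowered do not
depend on that change. -/
lemma chain_mulVec_ket0_congr {x x' : ∀ l, X l} (k : ℕ) (hk : k ≤ T) (p : Idx N T S A)
    (hp : ∀ i, x i ≠ x' i → p.2.2.2 i = 0) :
    (P.chain x k).mulVec P.ket0 p = (P.chain x' k).mulVec P.ket0 p := by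
  induction k generalizing p with
  | zero => rfl
  | succ k ih =>
    simp only [chain_succ_mulVec]
    refine Finset.sum_congr rfl fun q _ => ?_
    have step (hq : ∀ i, x i ≠ x' i → q.2.2.2 i = 0) :
        (extSC (P.U (k + 1))).mulVec ((P.chain x k).mulVec P.ket0) q =
          (extSC (P.U (k + 1))).mulVec ((P.chain x' k).mulVec P.ket0) q :=
      extSC_mulVec_congr _ fun r hr => ih (by omega) r (by rwa [hr])
    beta_reduce
    unfold Vmat
    split_ifs with hc hqp hcond
    · subst hqp
      rw [step hp]
    · simp
    · obtain ⟨-, -, hf, hl⟩ := hcond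
      by_cases hx : x (p.2.1.pred hc) = x' (p.2.1.pred hc)
      · rw [hx, step fun i hi => ?_]
        rw [hf i (by rintro rfl; exact hi hx)]
        exact hp i hi
      · have hlast : k < (q.2.2.2 (p.2.1.pred hc)).val := by
          have hv := congrArg Fin.val hl
          rw [hp _ hx, Fin.val_add_one] at hv
          split_ifs at hv with hlast
          · rw [hlast, Fin.val_last]
            omega
          · simp at hv
        have zero (y : ∀ l, X l) :
            (extSC (P.U (k + 1))).mulVec ((P.chain y k).mulVec P.ket0) q = 0 :=
          extSC_mulVec_eq_zero _ fun r hr =>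
            P.chain_mulVec_ket0_eq_zero y k r _ (by rwa [hr])
        rw [zero x, zero x', mul_zero, mul_zero]
    · simp

variable [∀ i, Fintype (X i)] [∀ i, DecidableEq (X i)]

lemma psi_congr {x x' : ∀ l, X l} {H : Hist N A X} (hagree : ∀ e ∈ H, x e.1 = x' e.1)
    (l : Fin (N + 1)) {t : ℕ} (ht : t ≤ T) : P.psi x l t H = P.psi x' l t H := by
  funext p
  refine if_ctx_congr Iff.rfl (fun hp => ?_) fun _ => rfl
  simp only [pre, ← Matrix.mulVec_mulVec]
  refine extSC_mulVec_congr _ fun q hq =>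
    P.chain_mulVec_ket0_congr _ (by omega) q fun i hi => ?_
  rw [hq]
  exact hp.2.2 i fun e he hei => hi (hei ▸ hagree e he)

lemma phiOf_congr {x x' : ∀ l, X l} {H : Hist N A X} (hagree : ∀ e ∈ H, x e.1 = x' e.1)
    {l : Fin N} (hl : x l = x' l) (a : A l) {t : ℕ} (ht : t ≤ T) :
    P.phiOf x l a t H = P.phiOf x' l a t H := by
  funext p
  refine if_ctx_congr Iff.rfl (fun _ => ?_) fun _ => rfl
  rw [P.psi_congr hagree l.succ ht]
  refine Finset.sum_congr rfl fun q _ => ?_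
  beta_reduce
  by_cases hq : q.2.1 = l.succ
  · congr 1
    unfold Vmat
    split_ifs with hc hqp hcond
    · rfl
    · rfl
    · have hpl : p.2.1.pred hc = l := by
        rw [Fin.pred_eq_iff_eq_succ, ← hcond.1, hq]
      have hx : x (p.2.1.pred hc) = x' (p.2.1.pred hc) := by rw [hpl, hl]
      rw [hx]
    · rfl
  · simp [psi, hq]

lemma numPsi_congr {x x' : ∀ l, X l} {H : Hist N A X} (hagree : ∀ e ∈ H, x e.1 = x' e.1)
    (l : Fin N) : P.numPsi x H l = P.numPsi x' H l :=
  Finset.sum_congr rfl fun _ ht => by rw [P.psi_congr hagree _ (Finset.mem_Icc.1 ht).2]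

lemma numPhi_congr {x x' : ∀ l, X l} {H : Hist N A X} (hagree : ∀ e ∈ H, x e.1 = x' e.1)
    {l : Fin N} (hl : x l = x' l) (a : A l) : P.numPhi x H l a = P.numPhi x' H l a :=
  Finset.sum_congr rfl fun _ ht => by rw [P.phiOf_congr hagree hl _ (Finset.mem_Icc.1 ht).2]

end Protocol

end CIQ

/-- Setting-locality: the protocol states `ψ_(l,t,H)` depend on the settings
`x⃗` only through the settings of labs occurring in the history `H`; consequently
the Definition-4 probabilities depend only on the settings appearing in the
conditioning history, and the Definition-5 probabilities depend only on those
together with the acting party's own setting. -/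
theorem setting_locality
    (N T : ℕ) (S : Type) [Fintype S] [DecidableEq S]
    (A : Fin N → Type) [∀ i, Fintype (A i)] [∀ i, DecidableEq (A i)]
    (X : Fin N → Type) [∀ i, Fintype (X i)] [∀ i, DecidableEq (X i)]
    (hN : 1 ≤ N) (hT : N ≤ T)
    (P : Protocol N T S A X) (hVm : P.unitaryVm) (hU : P.unitaryU)
    (x x' : ∀ l, X l) (H : Hist N A X) (hagree : ∀ e ∈ H, x e.1 = x' e.1) :
    (∀ (l : Fin (N + 1)) (t : ℕ), t ∈ Finset.Icc 1 T → P.psi x l t H = P.psi x' l t H) ∧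
    (∀ l : Fin N, P.pNext x H l = P.pNext x' H l) ∧
    (∀ l : Fin N, x l = x' l → ∀ a : A l, P.pOut x H l a = P.pOut x' H l a) := by
  refine ⟨fun l t ht => P.psi_congr hagree l (Finset.mem_Icc.1 ht).2, fun l => ?_,
    fun l hl a => ?_⟩
  · simp only [pNext, denPsi, P.numPsi_congr hagree]
  · simp only [pOut, P.numPhi_congr hagree hl]
end

section
/- The quantum switch distribution differs from the equal mixture of the two fixed-order versions of the same circuit: let p^{(A)} be the outcome distribution of the switch circuit with U_1 replaced by a unitary sending |0⟩_c to |1⟩_c (definite order Alice→Bob→Charlie), and p^{(B)} the distribution with U_1 replaced by a unitary sending |0⟩_c to |2⟩_c (definite order Bob→Alice→Charlie), everything else unchanged. Then (1/2)·p^{(A)}(000|011) + (1/2)·p^{(B)}(000|011) = 3/16, whereas the switch itself gives p^quantum(000|011) = 5/16; in particular the switch distribution is not the equal mixture of the two definite-order distributions. -/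
open CIQ CIQ.Protocol

noncomputable section

namespace CIQSwitch

/-- The measurement unitaries on `s₁ ⊗ r_l`: for setting `0` the computational-basis
measurement `|0⟩⟨0| ⊗ I + |1⟩⟨1| ⊗ X`, for setting `1` the Fourier-basis measurement
`|+⟩⟨+| ⊗ I + |−⟩⟨−| ⊗ X`, written out as matrices. -/
def meas : Fin 2 → Matrix (Fin 2 × Fin 2) (Fin 2 × Fin 2) ℂ
  | 0 => fun p q => if p.1 = q.1 ∧ p.2 = q.2 + q.1 then 1 else 0
  | 1 => fun p q =>
      (1 / 2) * ((if p.2 = q.2 then 1 else 0)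
        + (-1 : ℂ) ^ ((p.1 : ℕ) + (q.1 : ℕ)) * (if p.2 = q.2 + 1 then 1 else 0))

/-- `V_{s,r_l}(x_l)` for the switch: act with `meas x_l` on `s₁ ⊗ r_l` and trivially
on `s₂` (the system being the two qubits `s₁ ⊗ s₂`). -/
def VmSw (_ : Fin 3) (xv : Fin 2) :
    Matrix ((Fin 2 × Fin 2) × Fin 2) ((Fin 2 × Fin 2) × Fin 2) ℂ := fun p q =>
  if p.1.2 = q.1.2 then meas xv (p.1.1, p.2) (q.1.1, q.2) else 0

/-- Extension of a control-only operator to `H_s ⊗ H_c`. -/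
def extC (M : Matrix (Fin 4) (Fin 4) ℂ) :
    Matrix ((Fin 2 × Fin 2) × Fin 4) ((Fin 2 × Fin 2) × Fin 4) ℂ := fun p q =>
  if p.1 = q.1 then M p.2 q.2 else 0

/-- `U₂`: exchange `|1⟩_c ↔ |2⟩_c`, fixing `|0⟩_c` and `|3⟩_c`. -/
def U2c : Matrix (Fin 4) (Fin 4) ℂ := fun i j =>
  if i = Equiv.swap (1 : Fin 4) 2 j then 1 else 0

/-- The switch protocol: `N = 3` parties (Alice `0`, Bob `1`, Charlie `2` in
`Fin 3`, i.e. paper labs `1,2,3`), `T = 3` time steps, two-qubit system initialized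
`|00⟩`, given `U₁` (any unitary extension sending `|0⟩_c` to `(|1⟩_c+|2⟩_c)/√2`),
the concrete `U₂`, and `U₃` (any unitary extension of the specified action). -/
def switchP (U1c : Matrix (Fin 4) (Fin 4) ℂ)
    (U3 : Matrix ((Fin 2 × Fin 2) × Fin 4) ((Fin 2 × Fin 2) × Fin 4) ℂ) :
    Protocol 3 3 (Fin 2 × Fin 2) (fun _ => Fin 2) (fun _ => Fin 2) where
  s0 := (0, 0)
  r0 := fun _ => 0
  Vm := VmSw
  U := fun t => if t = 1 then extC U1c else if t = 2 then extC U2c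
    else if t = 3 then U3 else 1

/-- The settings `x = 0` (Alice), `y = 1` (Bob), `z = 1` (Charlie). -/
def xsw : Fin 3 → Fin 2 := fun l => if l = 0 then 0 else 1

/-- The hypotheses on the unitaries `U₁` and `U₃`:
`U₁` is a unitary on the control with `U₁|0⟩_c = (|1⟩_c + |2⟩_c)/√2`, and `U₃` is a
unitary on control and system with `U₃|1⟩_c|ψ⟩_{s₁}|0⟩_{s₂} = |3⟩_c|0⟩_{s₁}|ψ⟩_{s₂}`
and `U₃|2⟩_c|ψ⟩_{s₁}|0⟩_{s₂} = |3⟩_c|1⟩_{s₁}|ψ⟩_{s₂}`. -/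
def switchHyp (U1c : Matrix (Fin 4) (Fin 4) ℂ)
    (U3 : Matrix ((Fin 2 × Fin 2) × Fin 4) ((Fin 2 × Fin 2) × Fin 4) ℂ) : Prop :=
  U1c ∈ Matrix.unitaryGroup (Fin 4) ℂ ∧
  (∀ i : Fin 4, U1c i 0 = if i = 1 ∨ i = 2 then ((Real.sqrt 2 : ℂ))⁻¹ else 0) ∧
  U3 ∈ Matrix.unitaryGroup ((Fin 2 × Fin 2) × Fin 4) ℂ ∧
  (∀ (s1 : Fin 2) (p : (Fin 2 × Fin 2) × Fin 4),
    U3 p ((s1, 0), 1) = if p = (((0 : Fin 2), s1), 3) then 1 else 0) ∧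
  (∀ (s1 : Fin 2) (p : (Fin 2 × Fin 2) × Fin 4),
    U3 p ((s1, 0), 2) = if p = (((1 : Fin 2), s1), 3) then 1 else 0)

section Kets

variable {N T : ℕ} {S : Type} [DecidableEq S]
variable {A : Fin N → Type} [∀ i, DecidableEq (A i)] {X : Fin N → Type}

/-- The basis vector of the total Hilbert space with index `p`. -/
def ket (p : Idx N T S A) : Idx N T S A → ℂ := Pi.single p 1

lemma ket_apply (p q : Idx N T S A) : ket p q = if q = p then 1 else 0 :=
  Pi.single_apply p 1 q

/-- Projection of the result registers onto the outcomes `a`. -/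
def resultProj (a : ∀ i, A i) : (Idx N T S A → ℂ) →ₗ[ℂ] (Idx N T S A → ℂ) where
  toFun v p := if p.2.2.1 = a then v p else 0
  map_add' v w := by ext p; by_cases h : p.2.2.1 = a <;> simp [h]
  map_smul' z v := by ext p; by_cases h : p.2.2.1 = a <;> simp [h]

lemma resultProj_ket (a : ∀ i, A i) (p : Idx N T S A) :
    resultProj a (ket p) = if p.2.2.1 = a then ket p else 0 := by
  ext q
  by_cases hq : q = p
  · subst hq
    by_cases h : q.2.2.1 = a <;> simp [resultProj, h]
  · by_cases h : p.2.2.1 = a <;> simp [resultProj, h, ket_apply, hq]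

variable [Fintype S] [∀ i, Fintype (A i)]

/-- The lab-activation unitary on a basis vector whose control selects the lab `l`. -/
lemma Vmat_mulVec_ket (P : Protocol N T S A X) (x : ∀ l, X l) (s : S) (l : Fin N)
    (r : ∀ i, A i) (f : Fin N → Fin (T + 1)) :
    (P.Vmat x).mulVec (ket (s, l.succ, r, f)) =
      ∑ s' : S, ∑ a : A l, P.Vm l (x l) (s', a) (s, r l) •
        ket (s', l.succ, Function.update r l a, Function.update f l (f l + 1)) := by
  ext ⟨s', c, r', f'⟩
  rw [ket, Matrix.mulVec_single_one]
  simp only [Matrix.col_apply, Finset.sum_apply, Pi.smul_apply, ket_apply, smul_eq_mul,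
    Prod.mk.injEq, mul_ite, mul_one, mul_zero, Protocol.Vmat]
  by_cases hc : c = l.succ
  · subst hc
    rw [dif_neg (Fin.succ_ne_zero l)]
    simp only [Fin.pred_succ, true_and]
    rw [Finset.sum_eq_single s' (fun b _ hb => by simp [Ne.symm hb]) (by simp),
      Finset.sum_eq_single (r' l) _ (by simp)]
    · refine if_congr ?_ rfl rfl
      simp only [Function.eq_update_iff, true_and]
      grind
    · intro a _ ha
      rw [if_neg]
      rintro ⟨-, h, -⟩
      exact ha (by simp [h])
  · simp only [hc, false_and, and_false, if_false, Finset.sum_const_zero]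
    split_ifs with h0 h1 h1
    · exact absurd h1.2.1.symm hc
    · rfl
    · exact absurd h1.1.symm hc
    · rfl

/-- An operator on system and control acting on a basis vector. -/
lemma extSC_mulVec_ket (M : Matrix (S × Fin (N + 1)) (S × Fin (N + 1)) ℂ) (s : S)
    (c : Fin (N + 1)) (r : ∀ i, A i) (f : Fin N → Fin (T + 1)) :
    (extSC M).mulVec (ket (s, c, r, f)) =
      ∑ p : S × Fin (N + 1), M p (s, c) • (ket (p.1, p.2, r, f) : Idx N T S A → ℂ) := by
  ext ⟨s', c', r', f'⟩
  rw [ket, Matrix.mulVec_single_one]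
  simp only [Matrix.col_apply, Finset.sum_apply, Pi.smul_apply, ket_apply, smul_eq_mul,
    Prod.mk.injEq, mul_ite, mul_one, mul_zero, extSC]
  rw [Finset.sum_eq_single (s', c')]
  · simp
  · rintro ⟨s₁, c₁⟩ - h
    rw [if_neg]
    rintro ⟨rfl, rfl, -⟩
    exact h rfl
  · simp

/-- Squared norm of a vector with fixed control, result and flag values. -/
lemma nsq_sum_smul_ket (z : S → ℂ) (c : Fin (N + 1)) (r : ∀ i, A i)
    (f : Fin N → Fin (T + 1)) :
    nsq (∑ s, z s • (ket (s, c, r, f) : Idx N T S A → ℂ)) = ∑ s, Complex.normSq (z s) := by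
  rw [nsq, Fintype.sum_prod_type]
  refine Finset.sum_congr rfl fun s _ => ?_
  rw [Finset.sum_eq_single (c, r, f)]
  · simp [Finset.sum_apply, ket_apply]
  · intro q _ hq
    simp [Finset.sum_apply, ket_apply, hq]
  · simp

end Kets

/-- Basis vectors of the switch: system qubits `s t`, control `c`, result registers
`a b e` and flags `i j k` of Alice, Bob and Charlie. -/
def swKet (s t : Fin 2) (c : Fin 4) (a b e : Fin 2) (i j k : Fin 4) :
    Idx 3 3 (Fin 2 × Fin 2) (fun _ => Fin 2) → ℂ :=
  ket ((s, t), c, ![a, b, e], ![i, j, k])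

section Switch

variable (U : Matrix (Fin 4) (Fin 4) ℂ)
  (U3 : Matrix ((Fin 2 × Fin 2) × Fin 4) ((Fin 2 × Fin 2) × Fin 4) ℂ)

lemma Vmat_alice (s t a b e : Fin 2) (i j k : Fin 4) :
    ((switchP U U3).Vmat xsw).mulVec (swKet s t 1 a b e i j k) =
      swKet s t 1 (a + s) b e (i + 1) j k := by
  have h := Vmat_mulVec_ket (T := 3) (switchP U U3) xsw (s, t) 0 ![a, b, e] ![i, j, k]
  refine h.trans ?_
  have hu (a' : Fin 2) : Function.update ![a, b, e] 0 a' = ![a', b, e] := by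
    ext n; fin_cases n <;> rfl
  have hf : Function.update ![i, j, k] 0 (i + 1) = ![i + 1, j, k] := by
    ext n; fin_cases n <;> rfl
  simp [Fintype.sum_prod_type, switchP, VmSw, xsw, meas, hu, hf, swKet, ite_and]

lemma Vmat_bob (s t a b e : Fin 2) (i j k : Fin 4) :
    ((switchP U U3).Vmat xsw).mulVec (swKet s t 2 a b e i j k) =
      ∑ s' : Fin 2, ∑ b' : Fin 2, meas 1 (s', b') (s, b) •
        swKet s' t 2 a b' e i (j + 1) k := by
  have h := Vmat_mulVec_ket (T := 3) (switchP U U3) xsw (s, t) 1 ![a, b, e] ![i, j, k]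
  refine h.trans ?_
  have hu (a' : Fin 2) : Function.update ![a, b, e] 1 a' = ![a, a', e] := by
    ext n; fin_cases n <;> rfl
  have hf : Function.update ![i, j, k] 1 (j + 1) = ![i, j + 1, k] := by
    ext n; fin_cases n <;> rfl
  fin_cases t <;>
    simp [Fintype.sum_prod_type, switchP, VmSw, xsw, hu, hf, swKet]

lemma Vmat_charlie (s t a b e : Fin 2) (i j k : Fin 4) :
    ((switchP U U3).Vmat xsw).mulVec (swKet s t 3 a b e i j k) =
      ∑ s' : Fin 2, ∑ e' : Fin 2, meas 1 (s', e') (s, e) •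
        swKet s' t 3 a b e' i j (k + 1) := by
  have h := Vmat_mulVec_ket (T := 3) (switchP U U3) xsw (s, t) 2 ![a, b, e] ![i, j, k]
  refine h.trans ?_
  have hu (a' : Fin 2) : Function.update ![a, b, e] 2 a' = ![a, b, a'] := by
    ext n; fin_cases n <;> rfl
  have hf : Function.update ![i, j, k] 2 (k + 1) = ![i, j, k + 1] := by
    ext n; fin_cases n <;> rfl
  fin_cases t <;>
    simp [Fintype.sum_prod_type, switchP, VmSw, xsw, hu, hf, swKet]

lemma extSC_extC_swKet (M : Matrix (Fin 4) (Fin 4) ℂ) (s t : Fin 2) (c : Fin 4)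
    (a b e : Fin 2) (i j k : Fin 4) :
    (extSC (extC M)).mulVec (swKet s t c a b e i j k) =
      ∑ c' : Fin 4, M c' c • swKet s t c' a b e i j k := by
  refine (extSC_mulVec_ket (extC M) (s, t) c _ _).trans ?_
  rw [Fintype.sum_prod_type, Finset.sum_eq_single (s, t)]
  · simp [extC, swKet]
  · intro p _ hp
    simp [extC, hp]
  · simp

lemma extSC_swKet_of_col {M : Matrix ((Fin 2 × Fin 2) × Fin 4) ((Fin 2 × Fin 2) × Fin 4) ℂ}
    {s t s' t' : Fin 2} {c c' : Fin 4}
    (hM : ∀ p, M p ((s, t), c) = if p = ((s', t'), c') then 1 else 0)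
    (a b e : Fin 2) (i j k : Fin 4) :
    (extSC M).mulVec (swKet s t c a b e i j k) = swKet s' t' c' a b e i j k := by
  refine (extSC_mulVec_ket M (s, t) c _ _).trans ?_
  simp [hM, swKet]

/-- Probability of the outcomes `000` when `U₁|0⟩_c = α|1⟩_c + β|2⟩_c`. -/
lemma pQ_switchP_zero {α β : ℂ}
    (hU : ∀ i : Fin 4, U i 0 = if i = 1 then α else if i = 2 then β else 0)
    (h1 : ∀ (s : Fin 2) (p : (Fin 2 × Fin 2) × Fin 4),
      U3 p ((s, 0), 1) = if p = (((0 : Fin 2), s), 3) then 1 else 0)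
    (h2 : ∀ (s : Fin 2) (p : (Fin 2 × Fin 2) × Fin 4),
      U3 p ((s, 0), 2) = if p = (((1 : Fin 2), s), 3) then 1 else 0) :
    (switchP U U3).pQ xsw (fun _ => 0) =
      (Complex.normSq (α + β) + Complex.normSq α) / 8 := by
  have hket : (switchP U U3).ket0 (T := 3) = swKet 0 0 0 0 0 0 0 0 0 := by
    have hr : (![0, 0, 0] : Fin 3 → Fin 2) = fun _ => 0 := by decide
    have hf : (![0, 0, 0] : Fin 3 → Fin 4) = fun _ => 0 := by decide
    ext p
    rw [swKet, hr, hf, ket_apply]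
    rfl
  have hproj (s t : Fin 2) (c : Fin 4) (a b e : Fin 2) (i j k : Fin 4) :
      resultProj (fun _ => 0) (swKet s t c a b e i j k) =
        if a = 0 ∧ b = 0 ∧ e = 0 then swKet s t c a b e i j k else 0 := by
    refine (resultProj_ket _ _).trans (if_congr ?_ rfl rfl)
    simp [funext_iff, Fin.forall_fin_succ]
  have key : resultProj (fun _ => 0)
      (((switchP U U3).Uop xsw).mulVec (switchP U U3).ket0) =
      ∑ s : Fin 2 × Fin 2, (if s.2 = 0 then (α + β) / 4 else α / 4) •
        swKet s.1 s.2 3 0 0 0 1 1 1 := by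
    have e1 : (switchP U U3).U 1 = extC U := rfl
    have e2 : (switchP U U3).U 2 = extC U2c := rfl
    have e3 : (switchP U U3).U 3 = U3 := rfl
    have c21 : ∀ c : Fin 4, U2c c 1 = if c = 2 then 1 else 0 := by
      intro c; simp [U2c]
    have c22 : ∀ c : Fin 4, U2c c 2 = if c = 1 then 1 else 0 := by
      intro c; simp [U2c]
    simp only [Protocol.Uop, Protocol.chain, Nat.reduceAdd, zero_add, e1, e2, e3,
      ← Matrix.mulVec_mulVec, Matrix.one_mulVec, hket, extSC_extC_swKet, hU]
    have s1 : ∑ c : Fin 4, (if c = 1 then α else if c = 2 then β else 0) •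
        swKet 0 0 c 0 0 0 0 0 0 = α • swKet 0 0 1 0 0 0 0 0 0 + β • swKet 0 0 2 0 0 0 0 0 0 := by
      simp [Fin.sum_univ_four]
    rw [s1]
    simp only [Matrix.mulVec_add, Matrix.mulVec_smul, Vmat_alice, Vmat_bob, Vmat_charlie,
      Fin.sum_univ_two, extSC_extC_swKet, c21, c22, ite_smul, one_smul,
      zero_smul, Finset.sum_ite_eq', Finset.mem_univ, if_true,
      extSC_swKet_of_col (h1 _), extSC_swKet_of_col (h2 _), map_add, map_smul, hproj,
      Fintype.sum_prod_type]
    simp [meas]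
    module
  have hn := nsq_sum_smul_ket (N := 3) (T := 3) (A := fun _ => Fin 2)
    (fun s : Fin 2 × Fin 2 => if s.2 = 0 then (α + β) / 4 else α / 4) 3 ![0, 0, 0] ![1, 1, 1]
  refine (congrArg nsq key).trans (hn.trans ?_)
  simp only [Fintype.sum_prod_type, Fin.sum_univ_two, if_true, one_ne_zero, if_false,
    Complex.normSq_div]
  norm_num [Complex.normSq_ofNat]
  ring

end Switch

/-- The switch distribution differs from the equal mixture of the two fixed-order
versions of the same circuit: with `U₁` replaced by a unitary sending `|0⟩_c` to
`|1⟩_c` (order Alice→Bob→Charlie) or to `|2⟩_c` (order Bob→Alice→Charlie), the equal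
mixture gives `3/16` at outcomes `000` with settings `011`, whereas the switch gives
`5/16`; in particular the switch distribution is not that equal mixture. -/
theorem switch_not_mixture_of_orders
    (U1c U1A U1B : Matrix (Fin 4) (Fin 4) ℂ)
    (U3 : Matrix ((Fin 2 × Fin 2) × Fin 4) ((Fin 2 × Fin 2) × Fin 4) ℂ)
    (h : switchHyp U1c U3)
    (hA : U1A ∈ Matrix.unitaryGroup (Fin 4) ℂ)
    (hAact : ∀ i : Fin 4, U1A i 0 = if i = 1 then 1 else 0)
    (hB : U1B ∈ Matrix.unitaryGroup (Fin 4) ℂ)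
    (hBact : ∀ i : Fin 4, U1B i 0 = if i = 2 then 1 else 0) :
    (1 / 2) * (switchP U1A U3).pQ xsw (fun _ => 0)
        + (1 / 2) * (switchP U1B U3).pQ xsw (fun _ => 0) = 3 / 16 ∧
    (switchP U1c U3).pQ xsw (fun _ => 0) = 5 / 16 ∧
    (1 / 2) * (switchP U1A U3).pQ xsw (fun _ => 0)
        + (1 / 2) * (switchP U1B U3).pQ xsw (fun _ => 0)
      ≠ (switchP U1c U3).pQ xsw (fun _ => 0) := by
  obtain ⟨-, hU, -, h1, h2⟩ := h
  have eA : (switchP U1A U3).pQ xsw (fun _ => 0) = 1 / 4 := by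
    rw [pQ_switchP_zero U1A U3 (α := 1) (β := 0) (by simpa using hAact) h1 h2]
    norm_num
  have eB : (switchP U1B U3).pQ xsw (fun _ => 0) = 1 / 8 := by
    rw [pQ_switchP_zero U1B U3 (α := 0) (β := 1) (fun i => ?_) h1 h2]
    · norm_num
    · rw [hBact]
      grind
  have eC : (switchP U1c U3).pQ xsw (fun _ => 0) = 5 / 16 := by
    rw [pQ_switchP_zero U1c U3 (α := (Real.sqrt 2 : ℂ)⁻¹) (β := (Real.sqrt 2 : ℂ)⁻¹)
      (fun i => ?_) h1 h2]
    · rw [← two_mul]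
      norm_num [Complex.normSq_mul, Complex.normSq_ofReal, Complex.normSq_ofNat]
    · rw [hU]
      grind
  rw [eA, eB, eC]
  norm_num

end CIQSwitch

end
end
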